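/- arXiv:1108.1069 — 9 statements merged into one kernel-verified Lean document; each statement's English description precedes it below -/
import Mathlib

section
/- Let X be a compactum and let G ⊆ exp X be a family such that whenever A ∈ G and A ⊆ A' for A' ∈ exp X, also A' ∈ G. Then G is closed in the Vietoris topology on exp X if and only if for every nonempty collection ℱ ⊆ G that is filtered (downward directed by inclusion), the intersection ⋂ℱ belongs to G. -/
open Set Topology

/-- The hyperspace `exp X` of all nonempty closed subsets of `X`. -/
structure Exp (X : Type*) [TopologicalSpace X] where
  carrier : Set X
  isClosed' : IsClosed carrier
  nonempty' : carrier.Nonempty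

namespace Exp

variable {X : Type*} [TopologicalSpace X]

/-- The Vietoris topology on `exp X`, generated by the subbase consisting of the sets
`⟨U⟩ = {F | F ⊆ U}` and `⟨X, U⟩ = {F | F ∩ U ≠ ∅}` for open `U ⊆ X`. -/
instance topologicalSpace : TopologicalSpace (Exp X) :=
  TopologicalSpace.generateFrom
    ({S | ∃ U : Set X, IsOpen U ∧ S = {F : Exp X | F.carrier ⊆ U}} ∪
     {S | ∃ U : Set X, IsOpen U ∧ S = {F : Exp X | (F.carrier ∩ U).Nonempty}})

/-- The whole space `X` as an element of `exp X`. -/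
def univ (X : Type*) [TopologicalSpace X] [Nonempty X] : Exp X :=
  ⟨Set.univ, isClosed_univ, Set.univ_nonempty⟩

/-- Union of two elements of `exp X`. -/
def union (F G : Exp X) : Exp X :=
  ⟨F.carrier ∪ G.carrier, F.isClosed'.union G.isClosed',
    Set.union_nonempty.mpr (Or.inl F.nonempty')⟩

end Exp

section AmbiguousRepresentations

variable {X Y Z : Type*} [TopologicalSpace X] [TopologicalSpace Y] [TopologicalSpace Z]

/-- An ambiguous representation between `X` and `Y`:
(a) antitone in the first argument and isotone in the second;
(b) `(A, Y) ∈ R` for all `A`;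
(c) all sets `AR = {B | (A,B) ∈ R}` are closed in the Vietoris topology. -/
def IsAmbRep [Nonempty Y] (R : Set (Exp X × Exp Y)) : Prop :=
  (∀ (A A' : Exp X) (B B' : Exp Y),
      (A, B) ∈ R → A'.carrier ⊆ A.carrier → B.carrier ⊆ B'.carrier → (A', B') ∈ R) ∧
  (∀ A : Exp X, (A, Exp.univ Y) ∈ R) ∧
  (∀ A : Exp X, IsClosed {B : Exp Y | (A, B) ∈ R})

/-- The relation `R^⊣ ⊆ exp Y × exp X`: `(B̃, Ã) ∈ R^⊣` iff for every `A ∈ exp X` with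
`A ∩ Ã = ∅` there exists `B ∈ AR` with `B ∩ B̃ = ∅`. -/
def sms (R : Set (Exp X × Exp Y)) : Set (Exp Y × Exp X) :=
  {p | ∀ A : Exp X, A.carrier ∩ p.2.carrier = ∅ →
      ∃ B : Exp Y, (A, B) ∈ R ∧ B.carrier ∩ p.1.carrier = ∅}

/-- A strict ambiguous representation: additionally all sets `RB = {A | (A,B) ∈ R}`
are closed. -/
def IsStrictAmbRep [Nonempty Y] (R : Set (Exp X × Exp Y)) : Prop :=
  IsAmbRep R ∧ ∀ B : Exp Y, IsClosed {A : Exp X | (A, B) ∈ R}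

/-- An open ambiguous representation: strict, pseudo-invertible, and `R^⊣` is strict. -/
def IsOpenAmbRep [Nonempty X] [Nonempty Y] (R : Set (Exp X × Exp Y)) : Prop :=
  IsStrictAmbRep R ∧ sms (sms R) = R ∧ IsStrictAmbRep (sms R)

/-- The composition `R ⊚ S`: `A (R ⊚ S)` is the closure of
`{C | ∃ B, (A,B) ∈ R ∧ (B,C) ∈ S}`. -/
def bcomp (R : Set (Exp X × Exp Y)) (S : Set (Exp Y × Exp Z)) : Set (Exp X × Exp Z) :=
  {p | p.2 ∈ closure {C : Exp Z | ∃ B : Exp Y, (p.1, B) ∈ R ∧ (B, C) ∈ S}}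

/-- The relational composition of `R` and `S`. -/
def rcomp (R : Set (Exp X × Exp Y)) (S : Set (Exp Y × Exp Z)) : Set (Exp X × Exp Z) :=
  {p | ∃ B : Exp Y, (p.1, B) ∈ R ∧ (B, p.2) ∈ S}

end AmbiguousRepresentations

namespace Exp

variable {X : Type*} [TopologicalSpace X]

theorem isOpen_setOf_subset {U : Set X} (hU : IsOpen U) :
    IsOpen {F : Exp X | F.carrier ⊆ U} :=
  TopologicalSpace.isOpen_generateFrom_of_mem (Or.inl ⟨U, hU, rfl⟩)

/-- A filtered family in `exp X` accumulates at its intersection. -/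
theorem mem_closure_of_eq_iInter [CompactSpace X] {F : Set (Exp X)} (hne : F.Nonempty)
    (hdir : ∀ A ∈ F, ∀ B ∈ F, ∃ C ∈ F, C.carrier ⊆ A.carrier ∧ C.carrier ⊆ B.carrier)
    {F0 : Exp X} (hF0 : F0.carrier = ⋂ A ∈ F, A.carrier) : F0 ∈ closure F := by
  have : Nonempty F := hne.to_subtype
  let l : Filter (Exp X) := ⨅ A : F, Filter.principal {C | C ∈ F ∧ C.carrier ⊆ A.1.carrier}
  have hl (A : F) : {C | C ∈ F ∧ C.carrier ⊆ A.1.carrier} ∈ l :=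
    Filter.mem_iInf_of_mem A (Filter.mem_principal_self _)
  have hlne : l.NeBot := by
    refine Filter.iInf_neBot_of_directed' ?_ fun A =>
      Filter.principal_neBot_iff.2 ⟨A, A.2, subset_rfl⟩
    intro A B
    obtain ⟨C, hC, hCA, hCB⟩ := hdir A A.2 B B.2
    exact ⟨⟨C, hC⟩, Filter.principal_mono.2 fun D hD => ⟨hD.1, hD.2.trans hCA⟩,
      Filter.principal_mono.2 fun D hD => ⟨hD.1, hD.2.trans hCB⟩⟩
  have hlim : Filter.Tendsto id l (𝓝 F0) := by
    refine TopologicalSpace.tendsto_nhds_generateFrom_iff.2 ?_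
    rintro _ (⟨U, hU, rfl⟩ | ⟨U, hU, rfl⟩) hmem
    · obtain ⟨A, hA⟩ : ∃ A : F, A.1.carrier ⊆ U := by
        refine exists_subset_nhds_of_compactSpace (V := fun A : F => A.1.carrier) ?_
          (fun A => A.1.isClosed') fun x hx => hU.mem_nhds (hmem ?_)
        · intro A B
          obtain ⟨C, hC, hCA, hCB⟩ := hdir A A.2 B B.2
          exact ⟨⟨C, hC⟩, hCA, hCB⟩
        · rwa [hF0, biInter_eq_iInter]
      exact Filter.mem_of_superset (hl A) fun C hC => hC.2.trans hA
    · obtain ⟨A, hA⟩ := hne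
      refine Filter.mem_of_superset (hl ⟨A, hA⟩) fun C hC => ?_
      exact Set.Nonempty.mono
        (inter_subset_inter_left U (hF0.le.trans (biInter_subset_of_mem hC.1))) hmem
  obtain ⟨A, hA⟩ := hne
  exact mem_closure_of_tendsto hlim (Filter.mem_of_superset (hl ⟨A, hA⟩) fun C hC => hC.1)

/-- In a normal Hausdorff space, a closed set is the intersection of its closed neighbourhoods. -/
theorem carrier_eq_iInter_nhds [T4Space X] (A : Exp X) :
    A.carrier = ⋂ C ∈ {C : Exp X | A.carrier ⊆ interior C.carrier}, C.carrier := by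
  refine Subset.antisymm (subset_iInter₂ fun C hC => hC.trans interior_subset) fun x hx => ?_
  by_contra hxA
  obtain ⟨u, hu, hAu, hux⟩ := normal_exists_closure_subset A.isClosed'
    (isOpen_compl_singleton (x := x)) (subset_compl_singleton_iff.2 hxA)
  have hxu : x ∈ closure u := mem_iInter₂.1 hx
    ⟨closure u, isClosed_closure, (A.nonempty'.mono hAu).closure⟩
    (hAu.trans hu.subset_interior_closure)
  exact hux hxu rfl

end Exp

/-- For an upward-closed family `G ⊆ exp X` over a compactum `X`, `G` is closed in the
Vietoris topology iff `G` is stable under intersections of filtered collections. -/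
theorem statement0 {X : Type*} [TopologicalSpace X] [CompactSpace X] [T2Space X]
    (G : Set (Exp X))
    (hup : ∀ A A' : Exp X, A ∈ G → A.carrier ⊆ A'.carrier → A' ∈ G) :
    IsClosed G ↔
      ∀ F : Set (Exp X), F ⊆ G → F.Nonempty →
        (∀ A ∈ F, ∀ B ∈ F, ∃ C ∈ F, C.carrier ⊆ A.carrier ∧ C.carrier ⊆ B.carrier) →
        ∀ F0 : Exp X, F0.carrier = ⋂ A ∈ F, A.carrier → F0 ∈ G := by
  constructor
  · intro hG F hFG hne hdir F0 hF0
    exact closure_minimal hFG hG (Exp.mem_closure_of_eq_iInter hne hdir hF0)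
  · intro h
    refine isOpen_compl_iff.1 (isOpen_iff_mem_nhds.2 fun A hA => ?_)
    obtain ⟨C, hC, hCG⟩ : ∃ C : Exp X, A.carrier ⊆ interior C.carrier ∧ C ∉ G := by
      by_contra! hcon
      refine hA (h {C | A.carrier ⊆ interior C.carrier} hcon ?_ ?_ A A.carrier_eq_iInter_nhds)
      · exact ⟨⟨Set.univ, isClosed_univ, A.nonempty'.mono (subset_univ _)⟩, by simp⟩
      · intro B hB C hC
        have hBC : A.carrier ⊆ interior (B.carrier ∩ C.carrier) := by
          rw [interior_inter]
          exact subset_inter hB hC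
        exact ⟨⟨B.carrier ∩ C.carrier, B.isClosed'.inter C.isClosed',
          A.nonempty'.mono (hBC.trans interior_subset)⟩, hBC, inter_subset_left,
          inter_subset_right⟩
    refine Filter.mem_of_superset ((Exp.isOpen_setOf_subset isOpen_interior).mem_nhds hC) ?_
    exact fun B hB hBG => hCG (hup B C hBG (Subset.trans hB interior_subset))
end

section
/- If X, Y are compacta and R ⊆ exp X × exp Y is an ambiguous representation, then (R^⊣)^⊣ ⊆ R. -/
open Set Topology

/-- Every Vietoris neighbourhood of `B` contains all closed sets between `B` and some open
set `U ⊇ B`. -/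
theorem Exp.exists_isOpen_of_mem {Y : Type*} [TopologicalSpace Y] {O : Set (Exp Y)}
    (hO : IsOpen O) {B : Exp Y} (hB : B ∈ O) :
    ∃ U : Set Y, IsOpen U ∧ B.carrier ⊆ U ∧
      ∀ C : Exp Y, B.carrier ⊆ C.carrier → C.carrier ⊆ U → C ∈ O := by
  induction hO with
  | basic s hs =>
    rcases hs with ⟨U, hU, rfl⟩ | ⟨U, hU, rfl⟩
    · exact ⟨U, hU, hB, fun C _ hC => hC⟩
    · exact ⟨Set.univ, isOpen_univ, subset_univ _,
        fun C hC _ => hB.mono (inter_subset_inter_left U hC)⟩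
  | univ => exact ⟨Set.univ, isOpen_univ, subset_univ _, fun C _ _ => mem_univ C⟩
  | inter s t _ _ ihs iht =>
    obtain ⟨U, hU, hBU, hUs⟩ := ihs hB.1
    obtain ⟨V, hV, hBV, hVt⟩ := iht hB.2
    exact ⟨U ∩ V, hU.inter hV, subset_inter hBU hBV, fun C hBC hC =>
      ⟨hUs C hBC (hC.trans inter_subset_left), hVt C hBC (hC.trans inter_subset_right)⟩⟩
  | sUnion S _ ih =>
    obtain ⟨s, hs, hBs⟩ := hB
    obtain ⟨U, hU, hBU, hUs⟩ := ih s hs hBs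
    exact ⟨U, hU, hBU, fun C hBC hC => ⟨s, hs, hUs C hBC hC⟩⟩

/-- For any ambiguous representation `R`, `(R^⊣)^⊣ ⊆ R`. -/
theorem statement3 {X Y : Type*}
    [TopologicalSpace X] [CompactSpace X] [T2Space X] [Nonempty X]
    [TopologicalSpace Y] [CompactSpace Y] [T2Space Y] [Nonempty Y]
    (R : Set (Exp X × Exp Y)) (hR : IsAmbRep R) :
    sms (sms R) ⊆ R := by
  rintro ⟨A, B⟩ h
  obtain ⟨hmono, htop, hclosed⟩ := hR
  by_contra hAB
  obtain ⟨U, hU, hBU, hUR⟩ := Exp.exists_isOpen_of_mem (hclosed A).isOpen_compl hAB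
  have hne : Uᶜ.Nonempty := by
    rw [nonempty_compl]
    rintro rfl
    exact hUR (Exp.univ Y) (subset_univ _) (subset_univ _) (htop A)
  obtain ⟨A', hA', hdisj⟩ := h ⟨Uᶜ, hU.isClosed_compl, hne⟩
    (disjoint_compl_left_iff_subset.mpr hBU).inter_eq
  obtain ⟨B', hB', hB'U⟩ := hA' A (by rwa [inter_comm])
  have hB'sub : B'.carrier ⊆ U :=
    disjoint_compl_right_iff_subset.mp (disjoint_iff_inter_eq_empty.mpr hB'U)
  exact hUR (B.union B') subset_union_left (union_subset hBU hB'sub)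
    (hmono A A B' _ hB' Subset.rfl subset_union_right)
end

section
/- Let X, Y, Z be compacta and let R ⊆ exp X × exp Y, S ⊆ exp Y × exp Z be ambiguous representations. Then S^⊣ ⊚ R^⊣ ⊆ (R ⊚ S)^⊣. -/
open Set Topology

/-- For ambiguous representations `R`, `S`, one has `S^⊣ ⊚ R^⊣ ⊆ (R ⊚ S)^⊣`. -/
theorem statement5 {X Y Z : Type*}
    [TopologicalSpace X] [CompactSpace X] [T2Space X] [Nonempty X]
    [TopologicalSpace Y] [CompactSpace Y] [T2Space Y] [Nonempty Y]
    [TopologicalSpace Z] [CompactSpace Z] [T2Space Z] [Nonempty Z]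
    (R : Set (Exp X × Exp Y)) (S : Set (Exp Y × Exp Z))
    (hR : IsAmbRep R) (hS : IsAmbRep S) :
    bcomp (sms S) (sms R) ⊆ sms (bcomp R S) := by
  rintro ⟨C', A'⟩ h A hA
  have hopen : IsOpen {F : Exp X | F.carrier ⊆ A.carrierᶜ} :=
    TopologicalSpace.isOpen_generateFrom_of_mem
      (Or.inl ⟨A.carrierᶜ, A.isClosed'.isOpen_compl, rfl⟩)
  have hmem : A'.carrier ⊆ A.carrierᶜ := fun x hx hxA => by
    have : x ∈ A.carrier ∩ A'.carrier := ⟨hxA, hx⟩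
    simp only at hA
    rw [hA] at this
    exact this
  obtain ⟨A₁, hA₁, B₁, hCB, hBA⟩ := mem_closure_iff.1 h _ hopen hmem
  obtain ⟨B, hAB, hB⟩ := hBA A
    (disjoint_iff_inter_eq_empty.1 (subset_compl_iff_disjoint_left.1 hA₁))
  obtain ⟨C, hBC, hC⟩ := hCB B hB
  exact ⟨C, subset_closure ⟨B, hAB, hBC⟩, hC⟩
end

section
/- Let X, Y, Z be compacta and let R ⊆ exp X × exp Y and S ⊆ exp Y × exp Z be pseudo-invertible ambiguous representations. Then R ⊚ S ⊆ exp X × exp Z is a pseudo-invertible ambiguous representation, and (R ⊚ S)^⊣ = S^⊣ ⊚ R^⊣. -/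
open Set Topology

namespace Exp

variable {X : Type*} [TopologicalSpace X]

/-- Every neighbourhood of `B` contains, for some open `U ⊇ B`, all unions `F ∪ B` with `F ⊆ U`. -/
theorem exists_isOpen_union_mem {B : Exp X} {O : Set (Exp X)} (hO : IsOpen O) (hB : B ∈ O) :
    ∃ U : Set X, IsOpen U ∧ B.carrier ⊆ U ∧ ∀ F : Exp X, F.carrier ⊆ U → F.union B ∈ O := by
  induction hO with
  | basic s hs =>
    rcases hs with ⟨U, hU, rfl⟩ | ⟨U, -, rfl⟩
    · exact ⟨U, hU, hB, fun F hF => Set.union_subset hF hB⟩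
    · exact ⟨Set.univ, isOpen_univ, Set.subset_univ _,
        fun F _ => hB.mono (Set.inter_subset_inter_left _ Set.subset_union_right)⟩
  | univ => exact ⟨Set.univ, isOpen_univ, Set.subset_univ _, fun _ _ => trivial⟩
  | inter s t _ _ ihs iht =>
    obtain ⟨U, hU, hBU, hs⟩ := ihs hB.1
    obtain ⟨V, hV, hBV, ht⟩ := iht hB.2
    exact ⟨U ∩ V, hU.inter hV, Set.subset_inter hBU hBV, fun F hF =>
      ⟨hs F (hF.trans Set.inter_subset_left), ht F (hF.trans Set.inter_subset_right)⟩⟩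
  | sUnion K _ ih =>
    obtain ⟨s, hs, hBs⟩ := hB
    obtain ⟨U, hU, hBU, h⟩ := ih s hs hBs
    exact ⟨U, hU, hBU, fun F hF => ⟨s, hs, h F hF⟩⟩

theorem mem_closure_iff_of_upward {W : Set (Exp X)}
    (hW : ∀ F G : Exp X, F ∈ W → F.carrier ⊆ G.carrier → G ∈ W) {B : Exp X} :
    B ∈ closure W ↔
      ∀ U : Set X, IsOpen U → B.carrier ⊆ U → ∃ F ∈ W, F.carrier ⊆ U := by
  rw [mem_closure_iff]
  constructor
  · intro h U hU hBU
    obtain ⟨F, hFU, hF⟩ := h _ (isOpen_setOf_subset hU) hBU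
    exact ⟨F, hF, hFU⟩
  · intro h O hO hB
    obtain ⟨U, hU, hBU, hUO⟩ := exists_isOpen_union_mem hO hB
    obtain ⟨F, hF, hFU⟩ := h U hU hBU
    exact ⟨F.union B, hUO F hFU, hW F _ hF Set.subset_union_left⟩

/-- The complement of an open set other than the whole space. -/
def compl (U : Set X) (hU : IsOpen U) (hne : Uᶜ.Nonempty) : Exp X :=
  ⟨Uᶜ, hU.isClosed_compl, hne⟩

end Exp

section AmbiguousRepresentations

variable {X Y Z : Type*} [TopologicalSpace X] [TopologicalSpace Y] [TopologicalSpace Z]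

theorem isAmbRep_sms [Nonempty X] (R : Set (Exp X × Exp Y)) : IsAmbRep (sms R) := by
  have hmono : ∀ (B B' : Exp Y) (A A' : Exp X), (B, A) ∈ sms R → B'.carrier ⊆ B.carrier →
      A.carrier ⊆ A'.carrier → (B', A') ∈ sms R := by
    intro B B' A A' h hB hA D hD
    obtain ⟨E, hE, hEB⟩ :=
      h D (Set.subset_eq_empty (Set.inter_subset_inter_right _ hA) hD)
    exact ⟨E, hE, Set.subset_eq_empty (Set.inter_subset_inter_right _ hB) hEB⟩
  refine ⟨hmono, fun B A hA => ?_, fun B => ?_⟩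
  · exact absurd (by simpa [Exp.univ] using hA) A.nonempty'.ne_empty
  · refine isClosed_of_closure_subset fun A hA => ?_
    replace hA := (Exp.mem_closure_iff_of_upward
      fun F G hF hFG => hmono B B F G hF subset_rfl hFG).mp hA
    intro D hD
    obtain ⟨A', hA', hA'D⟩ := hA D.carrierᶜ D.isClosed'.isOpen_compl
      (Set.disjoint_iff_inter_eq_empty.mpr hD).symm.subset_compl_right
    exact hA' D (Set.disjoint_iff_inter_eq_empty.mp
      (Set.disjoint_right.mpr fun x hx => hA'D hx))

theorem mem_bcomp_iff [Nonempty Z] {R : Set (Exp X × Exp Y)} {S : Set (Exp Y × Exp Z)}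
    (hS : IsAmbRep S) {A : Exp X} {C : Exp Z} :
    (A, C) ∈ bcomp R S ↔ ∀ U : Set Z, IsOpen U → C.carrier ⊆ U →
      ∃ C' : Exp Z, (∃ B : Exp Y, (A, B) ∈ R ∧ (B, C') ∈ S) ∧ C'.carrier ⊆ U :=
  Exp.mem_closure_iff_of_upward (W := {C' | ∃ B : Exp Y, (A, B) ∈ R ∧ (B, C') ∈ S})
    fun F G ⟨B, hB, hF⟩ hFG => ⟨B, hB, hS.1 B B F G hF subset_rfl hFG⟩

theorem isAmbRep_bcomp [Nonempty Y] [Nonempty Z] {R : Set (Exp X × Exp Y)}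
    {S : Set (Exp Y × Exp Z)} (hR : IsAmbRep R) (hS : IsAmbRep S) : IsAmbRep (bcomp R S) := by
  refine ⟨fun A A' C C' h hA hC => ?_, fun A => ?_, fun A =>
    isClosed_closure (s := {C : Exp Z | ∃ B : Exp Y, (A, B) ∈ R ∧ (B, C) ∈ S})⟩
  · rw [mem_bcomp_iff hS] at h ⊢
    intro U hU hCU
    obtain ⟨D, ⟨B, hB, hD⟩, hDU⟩ := h U hU (hC.trans hCU)
    exact ⟨D, ⟨B, hR.1 A A' B B hB hA subset_rfl, hD⟩, hDU⟩
  · exact subset_closure ⟨Exp.univ Y, hR.2.1 A, hS.2.1 _⟩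

theorem bcomp_sms_subset [Nonempty X] (R : Set (Exp X × Exp Y)) (S : Set (Exp Y × Exp Z)) :
    bcomp (sms S) (sms R) ⊆ sms (bcomp R S) := by
  rintro ⟨C, A⟩ h
  refine ((isAmbRep_sms (bcomp R S)).2.2 C).closure_subset_iff.mpr ?_ h
  rintro A' ⟨B, hCB, hBA⟩ D hD
  obtain ⟨E, hDE, hEB⟩ := hBA D hD
  obtain ⟨F, hEF, hFC⟩ := hCB E hEB
  exact ⟨F, subset_closure ⟨E, hDE, hEF⟩, hFC⟩

theorem sms_bcomp [Nonempty X] [Nonempty Y] [Nonempty Z] {R : Set (Exp X × Exp Y)}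
    {S : Set (Exp Y × Exp Z)} (hS : IsAmbRep S) (hRpi : sms (sms R) = R)
    (hSpi : sms (sms S) = S) : sms (bcomp R S) = bcomp (sms S) (sms R) := by
  refine (bcomp_sms_subset R S).antisymm' ?_
  rintro ⟨C, A⟩ h
  rw [mem_bcomp_iff (isAmbRep_sms R)]
  intro U hU hAU
  rcases Uᶜ.eq_empty_or_nonempty with hUc | hUc
  · refine ⟨Exp.univ X, ⟨Exp.univ Y, (isAmbRep_sms S).2.1 C, (isAmbRep_sms R).2.1 _⟩, ?_⟩
    rw [Set.compl_empty_iff.mp hUc]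
    exact Set.subset_univ _
  · obtain ⟨D, hD, hDC⟩ := h (Exp.compl U hU hUc)
      (Set.disjoint_iff_inter_eq_empty.mp (Set.disjoint_compl_left_iff_subset.mpr hAU))
    obtain ⟨E, ⟨B, hB, hE⟩, hEC⟩ := (mem_bcomp_iff hS).mp hD _ C.isClosed'.isOpen_compl
      (Set.disjoint_iff_inter_eq_empty.mpr hDC).subset_compl_right
    rw [← hSpi] at hE
    rw [← hRpi] at hB
    obtain ⟨B', hCB', hB'B⟩ := hE C (Set.disjoint_iff_inter_eq_empty.mp
      (Set.disjoint_left.mpr fun x hx hxE => hEC hxE hx))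
    obtain ⟨A', hB'A', hA'⟩ := hB B' hB'B
    exact ⟨A', ⟨B', hCB', hB'A'⟩, Set.disjoint_compl_right_iff_subset.mp
      (Set.disjoint_iff_inter_eq_empty.mpr hA')⟩

end AmbiguousRepresentations

/-- The composition of pseudo-invertible ambiguous representations is a pseudo-invertible
ambiguous representation, and `(R ⊚ S)^⊣ = S^⊣ ⊚ R^⊣`. -/
theorem statement6 {X Y Z : Type*}
    [TopologicalSpace X] [CompactSpace X] [T2Space X] [Nonempty X]
    [TopologicalSpace Y] [CompactSpace Y] [T2Space Y] [Nonempty Y]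
    [TopologicalSpace Z] [CompactSpace Z] [T2Space Z] [Nonempty Z]
    (R : Set (Exp X × Exp Y)) (S : Set (Exp Y × Exp Z))
    (hR : IsAmbRep R) (hRpi : sms (sms R) = R)
    (hS : IsAmbRep S) (hSpi : sms (sms S) = S) :
    IsAmbRep (bcomp R S) ∧ sms (sms (bcomp R S)) = bcomp R S ∧
      sms (bcomp R S) = bcomp (sms S) (sms R) := by
  have h := sms_bcomp hS hRpi hSpi
  refine ⟨isAmbRep_bcomp hR hS, ?_, h⟩
  rw [h, sms_bcomp (isAmbRep_sms R) (congrArg sms hSpi) (congrArg sms hRpi), hRpi, hSpi]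
end

section
/- Let X, Y, Z be compacta. If R ⊆ exp X × exp Y and S ⊆ exp Y × exp Z are strict ambiguous representations, then their relational composition R ∘ S = {(A,C) ∈ exp X × exp Z : there is B ∈ exp Y with (A,B) ∈ R and (B,C) ∈ S} is a strict ambiguous representation between X and Z. -/
open Set Topology

namespace Exp

variable {X : Type*} [TopologicalSpace X]

/-- An open set of closed sets contains, with `F`, all sets between `F` and some open
neighbourhood of `F`. -/
theorem exists_open_forall_between_mem {O : Set (Exp X)} (hO : IsOpen O) {F : Exp X}
    (hF : F ∈ O) :
    ∃ U : Set X, IsOpen U ∧ F.carrier ⊆ U ∧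
      ∀ G : Exp X, F.carrier ⊆ G.carrier → G.carrier ⊆ U → G ∈ O := by
  induction hO with
  | basic s hs =>
    rcases hs with ⟨U, hU, rfl⟩ | ⟨U, hU, rfl⟩
    · exact ⟨U, hU, hF, fun _ _ h => h⟩
    · exact ⟨Set.univ, isOpen_univ, subset_univ _,
        fun _ h _ => hF.mono (inter_subset_inter_left U h)⟩
  | univ => exact ⟨Set.univ, isOpen_univ, subset_univ _, fun _ _ _ => mem_univ _⟩
  | inter s t _ _ ihs iht =>
    obtain ⟨U, hU, hFU, h⟩ := ihs hF.1
    obtain ⟨V, hV, hFV, h'⟩ := iht hF.2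
    exact ⟨U ∩ V, hU.inter hV, subset_inter hFU hFV, fun G hG hGU =>
      ⟨h G hG (hGU.trans inter_subset_left), h' G hG (hGU.trans inter_subset_right)⟩⟩
  | sUnion T _ ih =>
    obtain ⟨s, hs, hFs⟩ := hF
    obtain ⟨U, hU, hFU, h⟩ := ih s hs hFs
    exact ⟨U, hU, hFU, fun G hG hGU => ⟨s, hs, h G hG hGU⟩⟩

/-- In a normal space, an open set of closed sets contains, with `F`, a closed neighbourhood
of `F`. -/
theorem exists_mem_subset_interior [NormalSpace X] {O : Set (Exp X)} (hO : IsOpen O)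
    {F : Exp X} (hF : F ∈ O) : ∃ G ∈ O, F.carrier ⊆ interior G.carrier := by
  obtain ⟨U, hU, hFU, h⟩ := exists_open_forall_between_mem hO hF
  obtain ⟨V, hV, hFV, hVU⟩ := normal_exists_closure_subset F.isClosed' hU hFU
  have hFc : F.carrier ⊆ closure V := hFV.trans subset_closure
  exact ⟨⟨closure V, isClosed_closure, F.nonempty'.mono hFc⟩, h _ hFc hVU,
    hFV.trans (interior_maximal subset_closure hV)⟩

/-- If every point of a compact set has an open neighbourhood missed by almost all members of
a filter on the hyperspace, then almost all members miss the compact set. -/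
theorem eventually_disjoint_of_isCompact {K : Set X} (hK : IsCompact K) {f : Filter (Exp X)}
    (h : ∀ x ∈ K, ∃ U, IsOpen U ∧ x ∈ U ∧ ∀ᶠ F in f, Disjoint F.carrier U) :
    ∀ᶠ F in f, Disjoint F.carrier K := by
  refine hK.induction_on (p := fun s : Set X => ∀ᶠ F : Exp X in f, Disjoint F.carrier s) (by simp)
    (fun s t hst ht => ht.mono fun F hF => disjoint_of_subset_right hst hF)
    (fun s t hs ht => (hs.and ht).mono fun F hF => disjoint_union_right.2 hF) ?_
  intro x hx
  obtain ⟨U, hU, hxU, hf⟩ := h x hx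
  exact ⟨U, mem_nhdsWithin_of_mem_nhds (hU.mem_nhds hxU), hf⟩

instance compactSpace [CompactSpace X] : CompactSpace (Exp X) := by
  refine ⟨isCompact_iff_ultrafilter_le_nhds.2 fun f _ => ?_⟩
  set L : Set X := {x | ∀ U, IsOpen U → x ∈ U → ∀ᶠ F in (f : Filter (Exp X)),
    (F.carrier ∩ U).Nonempty} with hL
  have exists_disjoint : ∀ x ∉ L, ∃ U, IsOpen U ∧ x ∈ U ∧
      ∀ᶠ F in (f : Filter (Exp X)), Disjoint F.carrier U := by
    intro x hx
    simp only [hL, mem_ofPred_eq, not_forall] at hx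
    obtain ⟨U, hU, hxU, h⟩ := hx
    refine ⟨U, hU, hxU, (Ultrafilter.eventually_not.2 h).mono fun F hF => ?_⟩
    rwa [disjoint_iff_inter_eq_empty, ← not_nonempty_iff_eq_empty]
  have hLc : IsClosed L := by
    refine isOpen_compl_iff.1 (isOpen_iff_forall_mem_open.2 fun x hx => ?_)
    obtain ⟨U, hU, hxU, h⟩ := exists_disjoint x hx
    refine ⟨U, fun y hy hyL => ?_, hU, hxU⟩
    obtain ⟨F, hF, hF'⟩ := ((hyL U hU hy).and h).exists
    exact not_disjoint_iff_nonempty_inter.2 hF hF'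
  have eventually_subset : ∀ U, IsOpen U → L ⊆ U →
      ∀ᶠ F in (f : Filter (Exp X)), F.carrier ⊆ U := by
    intro U hU hLU
    refine (eventually_disjoint_of_isCompact hU.isClosed_compl.isCompact fun x hx =>
      exists_disjoint x fun hxL => hx (hLU hxL)).mono fun F hF => ?_
    exact disjoint_compl_right_iff_subset.1 hF
  have hLn : L.Nonempty := by
    by_contra hne
    obtain ⟨F, hF⟩ :=
      (eventually_subset ∅ isOpen_empty (not_nonempty_iff_eq_empty.1 hne).subset).exists
    exact F.nonempty'.ne_empty (subset_empty_iff.1 hF)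
  refine ⟨⟨L, hLc, hLn⟩, mem_univ _, ?_⟩
  rw [TopologicalSpace.nhds_generateFrom]
  refine le_iInf₂ fun s hs => Filter.le_principal_iff.2 ?_
  obtain ⟨hmem, ⟨U, hU, rfl⟩ | ⟨U, hU, rfl⟩⟩ := hs
  · exact eventually_subset U hU hmem
  · obtain ⟨x, hxL, hxU⟩ := hmem
    exact hxL U hU hxU

end Exp

/-- A strict ambiguous representation is closed in the product of the hyperspaces. -/
theorem IsStrictAmbRep.isClosed {X Y : Type*} [TopologicalSpace X] [TopologicalSpace Y]
    [NormalSpace Y] [Nonempty Y] {R : Set (Exp X × Exp Y)} (hR : IsStrictAmbRep R) :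
    IsClosed R := by
  obtain ⟨⟨hmono, -, hright⟩, hleft⟩ := hR
  refine isOpen_compl_iff.1 (isOpen_iff_forall_mem_open.2 ?_)
  rintro ⟨A, B⟩ hAB
  obtain ⟨G, hG, hBG⟩ := Exp.exists_mem_subset_interior (hright A).isOpen_compl hAB
  refine ⟨{A' | (A', G) ∈ R}ᶜ ×ˢ {B' : Exp Y | B'.carrier ⊆ interior G.carrier}, ?_,
    (hleft G).isOpen_compl.prod (Exp.isOpen_setOf_subset isOpen_interior), hG, hBG⟩
  rintro ⟨A', B'⟩ ⟨hA', hB'⟩ h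
  exact hA' (hmono A' A' B' G h Subset.rfl (hB'.trans interior_subset))

/-- The relational composition of closed relations through a compact hyperspace is closed. -/
theorem isClosed_rcomp {X Y Z : Type*} [TopologicalSpace X] [TopologicalSpace Y]
    [CompactSpace Y] [TopologicalSpace Z] {R : Set (Exp X × Exp Y)} {S : Set (Exp Y × Exp Z)}
    (hR : IsClosed R) (hS : IsClosed S) : IsClosed (rcomp R S) := by
  have hT : IsClosed {q : Exp Y × (Exp X × Exp Z) | (q.2.1, q.1) ∈ R ∧ (q.1, q.2.2) ∈ S} :=
    (hR.preimage (f := fun q : Exp Y × (Exp X × Exp Z) => (q.2.1, q.1)) (by fun_prop)).inter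
      (hS.preimage (f := fun q : Exp Y × (Exp X × Exp Z) => (q.1, q.2.2)) (by fun_prop))
  convert isClosedMap_snd_of_compactSpace _ hT using 1
  ext p
  simp [rcomp]

/-- The relational composition of strict ambiguous representations is a strict ambiguous
representation. -/
theorem statement8 {X Y Z : Type*}
    [TopologicalSpace X] [CompactSpace X] [T2Space X] [Nonempty X]
    [TopologicalSpace Y] [CompactSpace Y] [T2Space Y] [Nonempty Y]
    [TopologicalSpace Z] [CompactSpace Z] [T2Space Z] [Nonempty Z]
    (R : Set (Exp X × Exp Y)) (S : Set (Exp Y × Exp Z))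
    (hR : IsStrictAmbRep R) (hS : IsStrictAmbRep S) :
    IsStrictAmbRep (rcomp R S) := by
  have hclosed : IsClosed (rcomp R S) := isClosed_rcomp hR.isClosed hS.isClosed
  refine ⟨⟨?_, fun A => ⟨Exp.univ Y, hR.1.2.1 A, hS.1.2.1 _⟩, fun A => ?_⟩, fun C => ?_⟩
  · rintro A A' C C' ⟨B, hAB, hBC⟩ hA hC
    exact ⟨B, hR.1.1 A A' B B hAB hA Subset.rfl, hS.1.1 B B C C' hBC Subset.rfl hC⟩
  · exact hclosed.preimage (f := fun C => (A, C)) (by fun_prop)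
  · exact hclosed.preimage (f := fun A => (A, C)) (by fun_prop)
end

section
/- Let X, Y be compacta. If R, S ⊆ exp X × exp Y are open ambiguous representations, then both R ∩ S and R ∪ S are open ambiguous representations. -/
open Set Topology

section Lattice

variable {X Y : Type*} [TopologicalSpace X] [TopologicalSpace Y]

/-- `⊣` turns intersections of ambiguous representations into intersections. -/
theorem sms_inter [Nonempty Y] {R S : Set (Exp X × Exp Y)} (hR : IsAmbRep R) (hS : IsAmbRep S) :
    sms (R ∩ S) = sms R ∩ sms S := by
  ext ⟨B', A'⟩
  constructor
  · intro h
    refine ⟨fun A hA => ?_, fun A hA => ?_⟩ <;> obtain ⟨B, hB, hd⟩ := h A hA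
    · exact ⟨B, hB.1, hd⟩
    · exact ⟨B, hB.2, hd⟩
  · rintro ⟨h₁, h₂⟩ A hA
    obtain ⟨B₁, hB₁, hd₁⟩ := h₁ A hA
    obtain ⟨B₂, hB₂, hd₂⟩ := h₂ A hA
    refine ⟨B₁.union B₂, ⟨hR.1 _ _ _ _ hB₁ Subset.rfl subset_union_left,
      hS.1 _ _ _ _ hB₂ Subset.rfl subset_union_right⟩, ?_⟩
    change (B₁.carrier ∪ B₂.carrier) ∩ B'.carrier = ∅
    rw [union_inter_distrib_right, union_empty_iff]
    exact ⟨hd₁, hd₂⟩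

/-- `⊣` turns unions of ambiguous representations into unions. -/
theorem sms_union [Nonempty Y] {R S : Set (Exp X × Exp Y)} (hR : IsAmbRep R) (hS : IsAmbRep S) :
    sms (R ∪ S) = sms R ∪ sms S := by
  ext ⟨B', A'⟩
  constructor
  · intro h
    by_contra hn
    rw [mem_union, not_or] at hn
    simp only [sms, mem_ofPred_eq, not_forall] at hn
    obtain ⟨⟨A₁, hA₁, h₁⟩, A₂, hA₂, h₂⟩ := hn
    obtain ⟨B, hB | hB, hd⟩ := h (A₁.union A₂) (by
      change (A₁.carrier ∪ A₂.carrier) ∩ A'.carrier = ∅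
      rw [union_inter_distrib_right, union_empty_iff]
      exact ⟨hA₁, hA₂⟩)
    · exact h₁ ⟨B, hR.1 _ _ _ _ hB subset_union_left Subset.rfl, hd⟩
    · exact h₂ ⟨B, hS.1 _ _ _ _ hB subset_union_right Subset.rfl, hd⟩
  · rintro (h | h) A hA <;> obtain ⟨B, hB, hd⟩ := h A hA
    · exact ⟨B, Or.inl hB, hd⟩
    · exact ⟨B, Or.inr hB, hd⟩

theorem IsStrictAmbRep.inter [Nonempty Y] {R S : Set (Exp X × Exp Y)}
    (hR : IsStrictAmbRep R) (hS : IsStrictAmbRep S) : IsStrictAmbRep (R ∩ S) := by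
  obtain ⟨⟨hR₁, hR₂, hR₃⟩, hR₄⟩ := hR
  obtain ⟨⟨hS₁, hS₂, hS₃⟩, hS₄⟩ := hS
  exact ⟨⟨fun A A' B B' h hA hB => ⟨hR₁ A A' B B' h.1 hA hB, hS₁ A A' B B' h.2 hA hB⟩,
    fun A => ⟨hR₂ A, hS₂ A⟩, fun A => (hR₃ A).inter (hS₃ A)⟩,
    fun B => (hR₄ B).inter (hS₄ B)⟩

theorem IsStrictAmbRep.union [Nonempty Y] {R S : Set (Exp X × Exp Y)}
    (hR : IsStrictAmbRep R) (hS : IsStrictAmbRep S) : IsStrictAmbRep (R ∪ S) := by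
  obtain ⟨⟨hR₁, hR₂, hR₃⟩, hR₄⟩ := hR
  obtain ⟨⟨hS₁, hS₂, hS₃⟩, hS₄⟩ := hS
  exact ⟨⟨fun A A' B B' h hA hB => h.imp (hR₁ A A' B B' · hA hB) (hS₁ A A' B B' · hA hB),
    fun A => Or.inl (hR₂ A), fun A => (hR₃ A).union (hS₃ A)⟩,
    fun B => (hR₄ B).union (hS₄ B)⟩

end Lattice

/-- Intersections and unions of open ambiguous representations are open ambiguous
representations. -/
theorem statement13 {X Y : Type*}
    [TopologicalSpace X] [CompactSpace X] [T2Space X] [Nonempty X]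
    [TopologicalSpace Y] [CompactSpace Y] [T2Space Y] [Nonempty Y]
    (R S : Set (Exp X × Exp Y))
    (hR : IsOpenAmbRep R) (hS : IsOpenAmbRep S) :
    IsOpenAmbRep (R ∩ S) ∧ IsOpenAmbRep (R ∪ S) := by
  obtain ⟨hR, hRR, hR'⟩ := hR
  obtain ⟨hS, hSS, hS'⟩ := hS
  refine ⟨⟨hR.inter hS, ?_, ?_⟩, ⟨hR.union hS, ?_, ?_⟩⟩
  · rw [sms_inter hR.1 hS.1, sms_inter hR'.1 hS'.1, hRR, hSS]
  · rw [sms_inter hR.1 hS.1]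
    exact hR'.inter hS'
  · rw [sms_union hR.1 hS.1, sms_union hR'.1 hS'.1, hRR, hSS]
  · rw [sms_union hR.1 hS.1]
    exact hR'.union hS'
end

section
/- Let X, Y be compacta and R, S ⊆ exp X × exp Y ambiguous representations. Then (R ∪ S)^⊣ = R^⊣ ∪ S^⊣ and (R ∩ S)^⊣ = R^⊣ ∩ S^⊣. -/
open Set Topology

/-- `(R ∪ S)^⊣ = R^⊣ ∪ S^⊣` and `(R ∩ S)^⊣ = R^⊣ ∩ S^⊣` for ambiguous representations. -/
theorem statement14 {X Y : Type*}
    [TopologicalSpace X] [CompactSpace X] [T2Space X] [Nonempty X]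
    [TopologicalSpace Y] [CompactSpace Y] [T2Space Y] [Nonempty Y]
    (R S : Set (Exp X × Exp Y))
    (hR : IsAmbRep R) (hS : IsAmbRep S) :
    sms (R ∪ S) = sms R ∪ sms S ∧ sms (R ∩ S) = sms R ∩ sms S := by
  constructor
  · ext ⟨B', A'⟩
    constructor
    · intro h
      by_contra hn
      simp only [sms, mem_union, mem_ofPred_eq, not_or, not_forall] at hn
      obtain ⟨⟨A₁, h₁, hn₁⟩, ⟨A₂, h₂, hn₂⟩⟩ := hn
      obtain ⟨B, hB | hB, hBB⟩ := h (A₁.union A₂) (by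
        rw [Exp.union, union_inter_distrib_right, h₁, h₂, union_empty])
      · exact hn₁ ⟨B, hR.1 _ _ _ _ hB subset_union_left subset_rfl, hBB⟩
      · exact hn₂ ⟨B, hS.1 _ _ _ _ hB subset_union_right subset_rfl, hBB⟩
    · rintro (h | h) A hA
      · obtain ⟨B, hB, hBB⟩ := h A hA
        exact ⟨B, Or.inl hB, hBB⟩
      · obtain ⟨B, hB, hBB⟩ := h A hA
        exact ⟨B, Or.inr hB, hBB⟩
  · ext ⟨B', A'⟩
    constructor
    · intro h
      constructor <;> intro A hA <;> obtain ⟨B, hB, hBB⟩ := h A hA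
      · exact ⟨B, hB.1, hBB⟩
      · exact ⟨B, hB.2, hBB⟩
    · rintro ⟨h₁, h₂⟩ A hA
      obtain ⟨B₁, hB₁, hd₁⟩ := h₁ A hA
      obtain ⟨B₂, hB₂, hd₂⟩ := h₂ A hA
      refine ⟨B₁.union B₂, ⟨hR.1 _ _ _ _ hB₁ subset_rfl subset_union_left,
        hS.1 _ _ _ _ hB₂ subset_rfl subset_union_right⟩, ?_⟩
      rw [Exp.union, union_inter_distrib_right, hd₁, hd₂, union_empty]
end

section
/- Let L be a compact Lawson lattice and * : L × L → L a continuous operation that is monotone in both arguments and satisfies the infinite distributive laws with respect to infima in both arguments. For α, β, γ ∈ L, if γ ≪ α*β (γ is way below α*β), then there exist α', β' ∈ L with α' ≪ α, β' ≪ β, and γ ≤ α'*β'. -/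
open Set Topology

/-- `a` is way below `b`: for every nonempty directed set `D` with `b ≤ sup D` there is
`c ∈ D` with `a ≤ c`. -/
def WayBelow {L : Type*} [CompleteLattice L] (a b : L) : Prop :=
  ∀ D : Set L, D.Nonempty → DirectedOn (· ≤ ·) D → b ≤ sSup D → ∃ c ∈ D, a ≤ c

/-- Lower sets of points are closed in a Hausdorff topological meet-semilattice. -/
theorem isClosed_Iic_of_continuousInf {L : Type*} [SemilatticeInf L] [TopologicalSpace L]
    [T2Space L] [ContinuousInf L] (a : L) : IsClosed (Iic a) := by
  have : Iic a = {x | x ⊓ a = x} := by ext x; simp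
  rw [this]
  exact isClosed_eq (by fun_prop) continuous_id

/-- Upper sets of points are closed in a Hausdorff topological meet-semilattice. -/
theorem isClosed_Ici_of_continuousInf {L : Type*} [SemilatticeInf L] [TopologicalSpace L]
    [T2Space L] [ContinuousInf L] (a : L) : IsClosed (Ici a) := by
  have : Ici a = {x | a ⊓ x = a} := by ext x; simp
  rw [this]
  exact isClosed_eq (by fun_prop) continuous_const

/-- In a compact Hausdorff lattice, the supremum of a directed set lies in its closure. -/
theorem DirectedOn.sSup_mem_closure {L : Type*} [CompleteLattice L] [TopologicalSpace L]
    [CompactSpace L] [T2Space L] [ContinuousInf L] {D : Set L} (hne : D.Nonempty)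
    (hD : DirectedOn (· ≤ ·) D) : sSup D ∈ closure D := by
  have : Nonempty D := hne.to_subtype
  obtain ⟨x, hx⟩ := IsCompact.nonempty_iInter_of_directed_nonempty_isCompact_isClosed
    (fun d : D => closure (D ∩ Ici d.1))
    (by
      rintro ⟨a, ha⟩ ⟨b, hb⟩
      obtain ⟨c, hc, hac, hbc⟩ := hD a ha b hb
      exact ⟨⟨c, hc⟩, closure_mono (inter_subset_inter_right _ (Ici_subset_Ici.2 hac)),
        closure_mono (inter_subset_inter_right _ (Ici_subset_Ici.2 hbc))⟩)
    (fun d => ⟨d.1, subset_closure ⟨d.2, le_refl d.1⟩⟩)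
    (fun _ => isClosed_closure.isCompact) (fun _ => isClosed_closure)
  rw [mem_iInter] at hx
  obtain ⟨d, hd⟩ := hne
  have hxD : x ∈ closure D := closure_mono inter_subset_left (hx ⟨d, hd⟩)
  have hle : x ≤ sSup D :=
    closure_minimal (fun y hy => le_sSup hy) (isClosed_Iic_of_continuousInf (sSup D)) hxD
  have hge : sSup D ≤ x := sSup_le fun y hy =>
    closure_minimal inter_subset_right (isClosed_Ici_of_continuousInf y) (hx ⟨y, hy⟩)
  rwa [le_antisymm hge hle]

/-- In a compact Hausdorff lattice, the infimum of a downward directed set lies in its closure. -/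
theorem DirectedOn.sInf_mem_closure {L : Type*} [CompleteLattice L] [TopologicalSpace L]
    [CompactSpace L] [T2Space L] [ContinuousSup L] {D : Set L} (hne : D.Nonempty)
    (hD : DirectedOn (· ≥ ·) D) : sInf D ∈ closure D :=
  have : CompactSpace Lᵒᵈ := ‹CompactSpace L›
  have : T2Space Lᵒᵈ := ‹T2Space L›
  DirectedOn.sSup_mem_closure (L := Lᵒᵈ) hne hD

theorem wayBelow_bot {L : Type*} [CompleteLattice L] (b : L) : WayBelow ⊥ b := by
  rintro D ⟨d, hd⟩ - -
  exact ⟨d, hd, bot_le⟩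

theorem WayBelow.sup {L : Type*} [CompleteLattice L] {a a' b : L} (h : WayBelow a b)
    (h' : WayBelow a' b) : WayBelow (a ⊔ a') b := by
  intro D hne hD hb
  obtain ⟨c, hc, hac⟩ := h D hne hD hb
  obtain ⟨c', hc', hac'⟩ := h' D hne hD hb
  obtain ⟨e, he, hce, hce'⟩ := hD c hc c' hc'
  exact ⟨e, he, sup_le (hac.trans hce) (hac'.trans hce')⟩

/-- The infimum of a neighborhood of `b` is way below `b`. -/
theorem wayBelow_sInf_of_mem_nhds {L : Type*} [CompleteLattice L] [TopologicalSpace L]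
    [CompactSpace L] [T2Space L] [ContinuousInf L] {b : L} {V : Set L} (hV : V ∈ 𝓝 b) :
    WayBelow (sInf V) b := by
  intro D hne hD hb
  have hcl : sSup D ⊓ b ∈ closure ((· ⊓ b) '' D) :=
    image_closure_subset_closure_image (by fun_prop)
      (mem_image_of_mem _ (DirectedOn.sSup_mem_closure hne hD))
  rw [inf_eq_right.2 hb] at hcl
  obtain ⟨_, hyV, d, hd, rfl⟩ := mem_closure_iff_nhds.1 hcl V hV
  exact ⟨d, hd, (sInf_le hyV).trans inf_le_left⟩

/-- In a compact Hausdorff lattice with neighborhood bases of lower subsemilattices, every point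
is a limit of elements way below it. -/
theorem mem_closure_wayBelow {L : Type*} [CompleteLattice L] [TopologicalSpace L]
    [CompactSpace L] [T2Space L] [TopologicalLattice L]
    (hLow : ∀ x : L, ∀ N ∈ 𝓝 x, ∃ V ∈ 𝓝 x, V ⊆ N ∧ ∀ a ∈ V, ∀ b ∈ V, a ⊓ b ∈ V) (b : L) :
    b ∈ closure {a | WayBelow a b} := by
  rw [mem_closure_iff_nhds]
  intro N hN
  obtain ⟨C, hC, hCclosed, hCN⟩ := exists_mem_nhds_isClosed_subset hN
  obtain ⟨V, hV, hVC, hVinf⟩ := hLow b C hC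
  have hdir : DirectedOn (· ≥ ·) V := fun x hx y hy =>
    ⟨x ⊓ y, hVinf x hx y hy, inf_le_left, inf_le_right⟩
  exact ⟨sInf V, hCN (closure_minimal hVC hCclosed
    (DirectedOn.sInf_mem_closure ⟨b, mem_of_mem_nhds hV⟩ hdir)), wayBelow_sInf_of_mem_nhds hV⟩

/-- In a compact Lawson lattice, if `γ ≪ α * β` for a continuous monotone operation `*`
that is infinitely distributive over infima in both arguments, then `γ ≤ α' * β'` for some
`α' ≪ α`, `β' ≪ β`. -/
theorem statement16 {L : Type*} [CompleteLattice L] [TopologicalSpace L]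
    [CompactSpace L] [T2Space L] [TopologicalLattice L]
    (hdistrib : ∀ a b c : L, a ⊓ (b ⊔ c) = (a ⊓ b) ⊔ (a ⊓ c))
    (hLawsonUp : ∀ x : L, ∀ N ∈ 𝓝 x, ∃ V ∈ 𝓝 x, V ⊆ N ∧ ∀ a ∈ V, ∀ b ∈ V, a ⊔ b ∈ V)
    (hLawsonLow : ∀ x : L, ∀ N ∈ 𝓝 x, ∃ V ∈ 𝓝 x, V ⊆ N ∧ ∀ a ∈ V, ∀ b ∈ V, a ⊓ b ∈ V)
    (m : L → L → L)
    (hcont : Continuous fun p : L × L => m p.1 p.2)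
    (hmono : ∀ a a' b b' : L, a ≤ a' → b ≤ b' → m a b ≤ m a' b')
    (hdistl : ∀ (a : L) (S : Set L), S.Nonempty → m a (sInf S) = ⨅ s ∈ S, m a s)
    (hdistr : ∀ (b : L) (S : Set L), S.Nonempty → m (sInf S) b = ⨅ s ∈ S, m s b)
    (α β γ : L) (h : WayBelow γ (m α β)) :
    ∃ α' β' : L, WayBelow α' α ∧ WayBelow β' β ∧ γ ≤ m α' β' := by
  have hcl : m α β ∈ closure
      ((fun p : L × L => m p.1 p.2) '' ({a | WayBelow a α} ×ˢ {b | WayBelow b β})) := by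
    refine image_closure_subset_closure_image hcont (mem_image_of_mem _ (x := (α, β)) ?_)
    rw [closure_prod_eq]
    exact ⟨mem_closure_wayBelow hLawsonLow α, mem_closure_wayBelow hLawsonLow β⟩
  obtain ⟨_, ⟨⟨a, b⟩, ⟨ha, hb⟩, rfl⟩, hγ⟩ := h
    ((fun p : L × L => m p.1 p.2) '' ({a | WayBelow a α} ×ˢ {b | WayBelow b β}))
    ⟨_, (⊥, ⊥), ⟨wayBelow_bot α, wayBelow_bot β⟩, rfl⟩
    (by
      rintro _ ⟨⟨a, b⟩, ⟨ha, hb⟩, rfl⟩ _ ⟨⟨a', b'⟩, ⟨ha', hb'⟩, rfl⟩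
      exact ⟨_, ⟨(a ⊔ a', b ⊔ b'), ⟨WayBelow.sup ha ha', WayBelow.sup hb hb'⟩, rfl⟩,
        hmono _ _ _ _ le_sup_left le_sup_left, hmono _ _ _ _ le_sup_right le_sup_right⟩)
    (closure_minimal (fun y hy => le_sSup hy) (isClosed_Iic_of_continuousInf _) hcl)
  exact ⟨a, b, ha, hb, hγ⟩
end

section
/- Let X, Y be compacta, L a compact Lawson upper semilattice, and R ⊆ exp X × exp Y × L a subset such that whenever (A,B,α) ∈ R, A' ⊆ A (A' ∈ exp X), B ⊆ B' (B' ∈ exp Y), and α' ≤ α, then (A',B',α') ∈ R. Then R is closed in exp X × exp Y × L if and only if: (1) for all A ∈ exp X, α ∈ L, and every filtered collection ℬ of elements of exp Y with {A}×ℬ×{α} ⊆ R, one has (A, ⋂ℬ, α) ∈ R; and (2) for every B ∈ exp Y the set {(A,α) ∈ exp X × L : (A,B,α) ∈ R} is closed in exp X × L. -/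
open Set Topology

namespace Exp

variable {Y : Type*} [TopologicalSpace Y]

theorem isOpen_setOf_carrier_subset {U : Set Y} (hU : IsOpen U) :
    IsOpen {F : Exp Y | F.carrier ⊆ U} :=
  TopologicalSpace.isOpen_generateFrom_of_mem (Or.inl ⟨U, hU, rfl⟩)

/-- The intersection of a filtered family of nonempty closed sets lies in its Vietoris closure. -/
theorem mem_closure_of_carrier_eq_biInter [CompactSpace Y] {ℬ : Set (Exp Y)} (hne : ℬ.Nonempty)
    (hdir : ∀ B ∈ ℬ, ∀ B' ∈ ℬ, ∃ C ∈ ℬ, C.carrier ⊆ B.carrier ∧ C.carrier ⊆ B'.carrier)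
    {B₀ : Exp Y} (hB₀ : B₀.carrier = ⋂ B ∈ ℬ, B.carrier) : B₀ ∈ closure ℬ := by
  have : Nonempty ℬ := hne.to_subtype
  have hle : ∀ B ∈ ℬ, B₀.carrier ⊆ B.carrier := fun B hB => hB₀ ▸ biInter_subset_of_mem hB
  have hbasis : (⨅ B : ℬ, Filter.principal {C | C ∈ ℬ ∧ C.carrier ⊆ B.1.carrier}).HasBasis
      (fun _ : ℬ => True) fun B => {C | C ∈ ℬ ∧ C.carrier ⊆ B.1.carrier} := by
    refine Filter.hasBasis_iInf_principal fun B B' => ?_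
    obtain ⟨C, hC, h, h'⟩ := hdir B B.2 B' B'.2
    exact ⟨⟨C, hC⟩, fun D hD => ⟨hD.1, hD.2.trans h⟩, fun D hD => ⟨hD.1, hD.2.trans h'⟩⟩
  have hbot := hbasis.neBot_iff.mpr fun {B} _ => ⟨B.1, B.2, Subset.rfl⟩
  refine mem_closure_of_frequently_of_tendsto (f := id) (Filter.Eventually.frequently
    (hbasis.mem_iff.mpr ⟨Classical.arbitrary ℬ, trivial, fun C hC => hC.1⟩)) ?_
  refine TopologicalSpace.tendsto_nhds_generateFrom_iff.mpr ?_
  rintro _ (⟨U, hU, rfl⟩ | ⟨U, hU, rfl⟩) hmem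
  · have hsub : ⋂ B : ℬ, B.1.carrier ⊆ U := by
      rw [iInter_subtype, ← hB₀]
      exact hmem
    have hdir' : Directed (· ⊇ ·) fun B : ℬ => B.1.carrier := fun B B' => by
      obtain ⟨C, hC, h, h'⟩ := hdir B B.2 B' B'.2
      exact ⟨⟨C, hC⟩, h, h'⟩
    obtain ⟨B, hB⟩ := exists_subset_nhds_of_isCompact' hdir'
      (fun B => B.1.isClosed'.isCompact) (fun B => B.1.isClosed')
      (fun x hx => hU.mem_nhds (hsub hx))
    exact hbasis.mem_iff.mpr ⟨B, trivial, fun C hC => hC.2.trans hB⟩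
  · exact hbasis.mem_iff.mpr ⟨Classical.arbitrary ℬ, trivial, fun C hC =>
      hmem.mono (inter_subset_inter_left U (hle C hC.1))⟩

/-- A closed subset of a normal Hausdorff space is the intersection of its closed
neighbourhoods. -/
theorem carrier_eq_biInter_closed_nhds [NormalSpace Y] [T1Space Y] (B₀ : Exp Y) :
    B₀.carrier = ⋂ B ∈ {B : Exp Y | B₀.carrier ⊆ interior B.carrier}, B.carrier := by
  refine Subset.antisymm (subset_iInter₂ fun B hB => hB.trans interior_subset) fun y hy => ?_
  by_contra hyB
  obtain ⟨V, hV, hBV, hVy⟩ := normal_exists_closure_subset B₀.isClosed'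
    (isOpen_compl_singleton (x := y)) (subset_compl_singleton_iff.mpr hyB)
  have hint : B₀.carrier ⊆ interior (closure V) :=
    hBV.trans (interior_maximal subset_closure hV)
  exact hVy (mem_iInter₂.mp hy ⟨closure V, isClosed_closure,
    B₀.nonempty'.mono (hBV.trans subset_closure)⟩ hint) rfl

end Exp

/-- Closedness criterion for monotone subsets of `exp X × exp Y × L` for compacta `X`, `Y`
and a compact Lawson upper semilattice `L`. -/
theorem statement17 {X Y L : Type*}
    [TopologicalSpace X] [CompactSpace X] [T2Space X]
    [TopologicalSpace Y] [CompactSpace Y] [T2Space Y]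
    [SemilatticeSup L] [TopologicalSpace L] [CompactSpace L] [T2Space L] [ContinuousSup L]
    (hLawson : ∀ x : L, ∀ N ∈ 𝓝 x, ∃ V ∈ 𝓝 x, V ⊆ N ∧ ∀ a ∈ V, ∀ b ∈ V, a ⊔ b ∈ V)
    (R : Set (Exp X × Exp Y × L))
    (hmono : ∀ (A A' : Exp X) (B B' : Exp Y) (α α' : L),
      (A, B, α) ∈ R → A'.carrier ⊆ A.carrier → B.carrier ⊆ B'.carrier → α' ≤ α →
        (A', B', α') ∈ R) :
    IsClosed R ↔
      ((∀ (A : Exp X) (α : L), ∀ ℬ : Set (Exp Y), ℬ.Nonempty →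
          (∀ B ∈ ℬ, ∀ B' ∈ ℬ, ∃ C ∈ ℬ, C.carrier ⊆ B.carrier ∧ C.carrier ⊆ B'.carrier) →
          (∀ B ∈ ℬ, (A, B, α) ∈ R) →
          ∀ B0 : Exp Y, B0.carrier = ⋂ B ∈ ℬ, B.carrier → (A, B0, α) ∈ R) ∧
       (∀ B : Exp Y, IsClosed {q : Exp X × L | (q.1, B, q.2) ∈ R})) := by
  constructor
  · refine fun hR => ⟨fun A α ℬ hne hdir hℬ B₀ hB₀ => ?_, fun B => ?_⟩
    · have hcl : IsClosed {B : Exp Y | (A, B, α) ∈ R} := hR.preimage (by fun_prop)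
      exact closure_minimal hℬ hcl (Exp.mem_closure_of_carrier_eq_biInter hne hdir hB₀)
    · exact hR.preimage (f := fun q : Exp X × L => (q.1, B, q.2)) (by fun_prop)
  · rintro ⟨hfil, hsec⟩
    refine isClosed_of_closure_subset ?_
    rintro ⟨A₀, B₀, α₀⟩ hp
    refine hfil A₀ α₀ {B | B₀.carrier ⊆ interior B.carrier} ?_ ?_ ?_ B₀
      B₀.carrier_eq_biInter_closed_nhds
    · exact ⟨⟨univ, isClosed_univ, B₀.nonempty'.mono (subset_univ _)⟩, by simp⟩
    · intro B hB B' hB'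
      exact ⟨⟨B.carrier ∩ B'.carrier, B.isClosed'.inter B'.isClosed', B₀.nonempty'.mono
        (subset_inter (hB.trans interior_subset) (hB'.trans interior_subset))⟩,
        (subset_inter hB hB').trans interior_inter.ge, inter_subset_left, inter_subset_right⟩
    · intro B hB
      have hev : ∀ᶠ q : Exp X × Exp Y × L in 𝓝 (A₀, B₀, α₀), q.2.1.carrier ⊆ interior B.carrier :=
        (continuous_fst.comp continuous_snd).continuousAt.eventually
          ((Exp.isOpen_setOf_carrier_subset isOpen_interior).mem_nhds hB)
      have hfreq := ((mem_closure_iff_frequently.mp hp).and_eventually hev).mono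
        fun q hq => hmono q.1 q.1 q.2.1 B q.2.2 q.2.2 hq.1 Subset.rfl
          (hq.2.trans interior_subset) le_rfl
      have hcont : Continuous fun q : Exp X × Exp Y × L => (q.1, q.2.2) := by fun_prop
      exact (hsec B).closure_subset
        (mem_closure_of_frequently_of_tendsto hfreq (hcont.tendsto (A₀, B₀, α₀)))
end
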